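/- arXiv:1406.7331 — 3 statements merged into one kernel-verified Lean document; each statement's English description precedes it below -/
import Mathlib

section
/- Let R be a commutative ring, A a unit of R with inverse A⁻¹, and M an associative unital R-algebra with unit 1. Suppose P, Q ∈ M satisfy P·P = (A³ + A⁻³)·P, Q·Q = (A³ + A⁻³)·Q, and P·Q·P − P = Q·P·Q − Q. Then the elements σ = A²·1 − A⁻¹·P and τ = A²·1 − A⁻¹·Q satisfy the braid relation σ·τ·σ = τ·σ·τ. (This is the key identity showing that the Kuperberg sl(3) crossing expansion σᵢ = A²·I − A⁻¹·Pᵢ respects the third Reidemeister / braid relation.) -/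
/-- Expansion of the defect of the braid relation between `a - b P` and `a - b Q`. -/
theorem smul_one_sub_smul_braid_defect
    {R : Type*} [CommRing R] {M : Type*} [Ring M] [Algebra R M] (a b : R) (P Q : M) :
    (a • (1 : M) - b • P) * (a • (1 : M) - b • Q) * (a • (1 : M) - b • P) -
      (a • (1 : M) - b • Q) * (a • (1 : M) - b • P) * (a • (1 : M) - b • Q) =
    (a * b ^ 2) • (P * P - Q * Q) - (a ^ 2 * b) • (P - Q) -
      b ^ 3 • (P * Q * P - Q * P * Q) := by
  simp only [mul_sub, sub_mul, smul_mul_assoc, mul_smul_comm, one_mul, mul_one]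
  module

/-- The Kuperberg sl(3) crossing expansion `σ = A²·1 − A⁻¹·P` satisfies the braid
relation, given the quadratic relations `P² = (A³+A⁻³)P`, `Q² = (A³+A⁻³)Q` and
the graphical identity `PQP − P = QPQ − Q`. -/
theorem kuperberg_sl3_braid_relation
    {R : Type*} [CommRing R] {M : Type*} [Ring M] [Algebra R M]
    (A : Rˣ) (P Q : M)
    (hP : P * P = ((A : R) ^ 3 + ((A⁻¹ : Rˣ) : R) ^ 3) • P)
    (hQ : Q * Q = ((A : R) ^ 3 + ((A⁻¹ : Rˣ) : R) ^ 3) • Q)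
    (hPQ : P * Q * P - P = Q * P * Q - Q) :
    ((A : R) ^ 2 • (1 : M) - ((A⁻¹ : Rˣ) : R) • P) *
      ((A : R) ^ 2 • (1 : M) - ((A⁻¹ : Rˣ) : R) • Q) *
      ((A : R) ^ 2 • (1 : M) - ((A⁻¹ : Rˣ) : R) • P) =
    ((A : R) ^ 2 • (1 : M) - ((A⁻¹ : Rˣ) : R) • Q) *
      ((A : R) ^ 2 • (1 : M) - ((A⁻¹ : Rˣ) : R) • P) *
      ((A : R) ^ 2 • (1 : M) - ((A⁻¹ : Rˣ) : R) • Q) := by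
  have hA : (A : R) * ((A⁻¹ : Rˣ) : R) = 1 := A.mul_inv
  have hPQ' : P * Q * P - Q * P * Q = P - Q := by
    rw [sub_eq_sub_iff_add_eq_add] at hPQ ⊢
    rw [hPQ, add_comm]
  rw [← sub_eq_zero, smul_one_sub_smul_braid_defect, hP, hQ, hPQ', ← smul_sub, smul_smul,
    ← sub_smul, ← sub_smul]
  generalize ((A⁻¹ : Rˣ) : R) = b at *
  have h : ((A : R) ^ 2 * b ^ 2 * ((A : R) ^ 3 + b ^ 3) - ((A : R) ^ 2) ^ 2 * b - b ^ 3) = 0 := by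
    linear_combination
      ((A : R) ^ 4 * b + b ^ 3 * ((A : R) * b + 1)) * hA
  rw [h, zero_smul]
end

section
/- Let R be a commutative ring, A a unit of R with inverse A⁻¹, and M an associative unital R-algebra with unit 1. Let P : ℕ → M be a family of elements such that for all i, j: (i) P i · P i = (A³ + A⁻³)·P i; (ii) P i · P (i+1) · P i − P i = P (i+1) · P i · P (i+1) − P (i+1); (iii) P i · P j = P j · P i whenever |i − j| ≥ 2. Define σ i = A²·1 − A⁻¹·(P i). Then: (a) each σ i is invertible with inverse A⁻²·1 − A·(P i); (b) σ i · σ (i+1) · σ i = σ (i+1) · σ i · σ (i+1) for all i; and (c) σ i · σ j = σ j · σ i whenever |i − j| ≥ 2. Hence the assignment σᵢ ↦ A²·1 − A⁻¹·Pᵢ satisfies all the defining relations of the Artin braid group generators. -/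
theorem smul_one_sub_smul_mul {R M : Type*} [CommRing R] [Ring M] [Algebra R M]
    (s t u v : R) (p q : M) :
    (s • (1 : M) - t • p) * (u • (1 : M) - v • q) =
      (s * u) • (1 : M) - (s * v) • q - (t * u) • p + (t * v) • (p * q) := by
  simp only [sub_mul, mul_sub, smul_mul_smul_comm, one_mul, mul_one]
  module

theorem smul_one_sub_smul_mul_mul {R M : Type*} [CommRing R] [Ring M] [Algebra R M]
    (s t : R) (p q : M) :
    (s • (1 : M) - t • p) * (s • (1 : M) - t • q) * (s • (1 : M) - t • p) =
      s ^ 3 • (1 : M) - (s ^ 2 * t) • (p + p + q) +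
        (s * t ^ 2) • (p * q + q * p + p * p) - t ^ 3 • (p * q * p) := by
  simp only [sub_mul, mul_sub, smul_mul_smul_comm, one_mul, mul_one]
  module

theorem smul_one_sub_smul_mul_eq_one {R M : Type*} [CommRing R] [Ring M] [Algebra R M]
    {a b : R} (hab : a * b = 1) {p : M} (hp : p * p = (a ^ 3 + b ^ 3) • p) :
    (a ^ 2 • (1 : M) - b • p) * (b ^ 2 • (1 : M) - a • p) = 1 := by
  rw [smul_one_sub_smul_mul, hp]
  linear_combination (norm := module) ((a * b + 1) * hab) • (1 : M) + ((a ^ 3 + b ^ 3) * hab) • p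

theorem smul_one_sub_smul_braid {R M : Type*} [CommRing R] [Ring M] [Algebra R M]
    {a b : R} (hab : a * b = 1) {p q : M} (hp : p * p = (a ^ 3 + b ^ 3) • p)
    (hq : q * q = (a ^ 3 + b ^ 3) • q) (hpq : p * q * p - p = q * p * q - q) :
    (a ^ 2 • (1 : M) - b • p) * (a ^ 2 • (1 : M) - b • q) * (a ^ 2 • (1 : M) - b • p) =
      (a ^ 2 • (1 : M) - b • q) * (a ^ 2 • (1 : M) - b • p) * (a ^ 2 • (1 : M) - b • q) := by
  rw [smul_one_sub_smul_mul_mul, smul_one_sub_smul_mul_mul, hp, hq]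
  linear_combination (norm := module)
    ((a ^ 4 * b + b ^ 3 * (a * b + 1)) * hab) • (p - q) - b ^ 3 • hpq

theorem Commute.smul_one_sub_smul {R M : Type*} [CommRing R] [Ring M] [Algebra R M]
    (s t : R) {p q : M} (h : Commute p q) :
    Commute (s • (1 : M) - t • p) (s • (1 : M) - t • q) := by
  rw [Commute, SemiconjBy, smul_one_sub_smul_mul, smul_one_sub_smul_mul, h.eq]
  module

/-- The Kuperberg sl(3) expansion `σᵢ = A²·1 − A⁻¹·Pᵢ` of the braid generators
satisfies all the defining relations of the Artin braid group, given the
graphical identities satisfied by the `Pᵢ`. -/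
theorem kuperberg_sl3_braid_group_relations
    {R : Type*} [CommRing R] {M : Type*} [Ring M] [Algebra R M]
    (A : Rˣ) (P : ℕ → M)
    (h1 : ∀ i, P i * P i = ((A : R) ^ 3 + ((A⁻¹ : Rˣ) : R) ^ 3) • P i)
    (h2 : ∀ i, P i * P (i + 1) * P i - P i = P (i + 1) * P i * P (i + 1) - P (i + 1))
    (h3 : ∀ i j : ℕ, 2 ≤ |(i : ℤ) - (j : ℤ)| → P i * P j = P j * P i) :
    (∀ i, ((A : R) ^ 2 • (1 : M) - ((A⁻¹ : Rˣ) : R) • P i) *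
          (((A⁻¹ : Rˣ) : R) ^ 2 • (1 : M) - (A : R) • P i) = 1 ∧
        (((A⁻¹ : Rˣ) : R) ^ 2 • (1 : M) - (A : R) • P i) *
          ((A : R) ^ 2 • (1 : M) - ((A⁻¹ : Rˣ) : R) • P i) = 1) ∧
    (∀ i, ((A : R) ^ 2 • (1 : M) - ((A⁻¹ : Rˣ) : R) • P i) *
          ((A : R) ^ 2 • (1 : M) - ((A⁻¹ : Rˣ) : R) • P (i + 1)) *
          ((A : R) ^ 2 • (1 : M) - ((A⁻¹ : Rˣ) : R) • P i) =
        ((A : R) ^ 2 • (1 : M) - ((A⁻¹ : Rˣ) : R) • P (i + 1)) *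
          ((A : R) ^ 2 • (1 : M) - ((A⁻¹ : Rˣ) : R) • P i) *
          ((A : R) ^ 2 • (1 : M) - ((A⁻¹ : Rˣ) : R) • P (i + 1))) ∧
    (∀ i j : ℕ, 2 ≤ |(i : ℤ) - (j : ℤ)| →
        ((A : R) ^ 2 • (1 : M) - ((A⁻¹ : Rˣ) : R) • P i) *
          ((A : R) ^ 2 • (1 : M) - ((A⁻¹ : Rˣ) : R) • P j) =
        ((A : R) ^ 2 • (1 : M) - ((A⁻¹ : Rˣ) : R) • P j) *
          ((A : R) ^ 2 • (1 : M) - ((A⁻¹ : Rˣ) : R) • P i)) := by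
  have hab : (A : R) * ((A⁻¹ : Rˣ) : R) = 1 := A.mul_inv
  have hba : ((A⁻¹ : Rˣ) : R) * (A : R) = 1 := A.inv_mul
  refine ⟨fun i => ⟨smul_one_sub_smul_mul_eq_one hab (h1 i),
    smul_one_sub_smul_mul_eq_one hba ((h1 i).trans (by rw [add_comm]))⟩,
    fun i => smul_one_sub_smul_braid hab (h1 i) (h1 (i + 1)) (h2 i),
    fun i j hij => Commute.smul_one_sub_smul _ _ (h3 i j hij)⟩
end

section
/- Let v, e, f be natural numbers and let L be a multiset of natural numbers with cardinality f, such that the sum of L equals 2·e, 3·v = 2·e, v + f = e + 2, and every element of L is positive and even. Then some element of L equals 2 or 4. (This is the Euler-characteristic counting underlying the paper's claim that in an oriented trivalent bipartite plane graph all faces have an even number of edges, hence there is always a bigon or a quadrilateral; consequently the planar expansion of the Kuperberg sl(3) bracket reduces every classical state completely to a scalar.) -/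
/-- A trivalent graph embedded in the sphere all of whose faces have a positive
even number of sides always has a bigon or a quadrilateral: if `v`, `e`, `f`
and the multiset `L` of face lengths satisfy `card L = f`, `sum L = 2e`,
`3v = 2e`, Euler's formula `v + f = e + 2`, and every face length is positive
and even, then some face length equals `2` or `4`. -/
theorem cubic_planar_even_faces_has_bigon_or_square
    (v e f : ℕ) (L : Multiset ℕ)
    (hcard : Multiset.card L = f)
    (hsum : L.sum = 2 * e)
    (hcubic : 3 * v = 2 * e)
    (heuler : v + f = e + 2)
    (hpos : ∀ n ∈ L, 0 < n)
    (heven : ∀ n ∈ L, Even n) :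
    ∃ n ∈ L, n = 2 ∨ n = 4 := by
  by_contra! h
  have hsix : ∀ n ∈ L, 6 ≤ n := by
    intro n hn
    obtain ⟨k, hk⟩ := heven n hn
    have := hpos n hn
    have := h n hn
    omega
  have hle := Multiset.card_nsmul_le_sum hsix
  rw [smul_eq_mul, hcard, hsum] at hle
  omega
end
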